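/- Fix v̄ > 0, n ≥ 2, λ ∈ ℝ^n with λ ≥ 0, and r ∈ (0,v̄)^n. Define the corner-hitting LSA threshold functions p_i(v_{-i}) = r_i + (v̄ - r_i)·max{0, max_{j≠i} (v_j - r_j)/(v̄ - r_j)}. Then for each i, inf over v_{-i} ∈ [0,v̄]^{n-1} of (p_i(v_{-i}) - Σ_{j≠i} λ_j v_j) equals min{r_i - Σ_{j≠i} λ_j r_j, v̄(1 - Σ_{j≠i} λ_j)}. -/

import Mathlib

theorem stmt17 (n : ℕ) (hn : 2 ≤ n) (vbar : ℝ) (hvbar : 0 < vbar)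
    (lam r : Fin n → ℝ) (hlam : ∀ i, 0 ≤ lam i)
    (hr : ∀ i, 0 < r i ∧ r i < vbar) (i : Fin n) :
    IsLeast
      {x : ℝ | ∃ v : Fin n → ℝ, (∀ j, 0 ≤ v j ∧ v j ≤ vbar) ∧
        x = (r i + (vbar - r i) *
              ((Finset.univ.erase i).fold max 0 (fun j => (v j - r j) / (vbar - r j))))
            - ∑ j ∈ Finset.univ.erase i, lam j * v j}
      (min (r i - ∑ j ∈ Finset.univ.erase i, lam j * r j)
        (vbar * (1 - ∑ j ∈ Finset.univ.erase i, lam j))) := by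
  have hd : ∀ j, 0 < vbar - r j := fun j => sub_pos.2 (hr j).2
  constructor
  · rcases min_choice (r i - ∑ j ∈ Finset.univ.erase i, lam j * r j)
        (vbar * (1 - ∑ j ∈ Finset.univ.erase i, lam j)) with h | h
    · rw [h]
      refine ⟨r, fun j => ⟨(hr j).1.le, (hr j).2.le⟩, ?_⟩
      have h0 : (Finset.univ.erase i).fold max 0 (fun j => (r j - r j) / (vbar - r j)) = 0 := by
        apply le_antisymm
        · rw [Finset.fold_max_le]
          exact ⟨le_rfl, fun j _ => by simp⟩
        · rw [Finset.le_fold_max]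
          exact Or.inl le_rfl
      rw [h0]; ring
    · rw [h]
      refine ⟨fun _ => vbar, fun j => ⟨hvbar.le, le_rfl⟩, ?_⟩
      have h1 : (Finset.univ.erase i).fold max 0
          (fun j => (vbar - r j) / (vbar - r j)) = 1 := by
        apply le_antisymm
        · rw [Finset.fold_max_le]
          exact ⟨zero_le_one, fun j _ => (div_self (hd j).ne').le⟩
        · rw [Finset.le_fold_max]
          have : Nontrivial (Fin n) := Fin.nontrivial_iff_two_le.2 hn
          obtain ⟨j, hj⟩ := exists_ne i
          exact Or.inr ⟨j, by simp [hj], (div_self (hd j).ne').ge⟩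
      rw [h1, ← Finset.sum_mul]; ring
  · rintro x ⟨v, hv, rfl⟩
    set e := (Finset.univ.erase i).fold max 0 (fun j => (v j - r j) / (vbar - r j)) with he
    have e0 : 0 ≤ e := by
      rw [he, Finset.le_fold_max]
      exact Or.inl le_rfl
    have e1 : e ≤ 1 := by
      rw [he, Finset.fold_max_le]
      exact ⟨zero_le_one, fun j _ => (div_le_one (hd j)).2 (by linarith [(hv j).2])⟩
    have hle : ∀ j ∈ Finset.univ.erase i, v j ≤ (1 - e) * r j + e * vbar := by
      intro j hj
      have h2 : (v j - r j) / (vbar - r j) ≤ e := by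
        rw [he, Finset.le_fold_max]
        exact Or.inr ⟨j, hj, le_rfl⟩
      rw [div_le_iff₀ (hd j)] at h2
      linarith
    have hs : ∑ j ∈ Finset.univ.erase i, lam j * v j ≤
        (1 - e) * (∑ j ∈ Finset.univ.erase i, lam j * r j)
          + e * (vbar * ∑ j ∈ Finset.univ.erase i, lam j) := by
      rw [Finset.mul_sum, Finset.mul_sum, Finset.mul_sum, ← Finset.sum_add_distrib]
      refine Finset.sum_le_sum fun j hj => ?_
      have := mul_le_mul_of_nonneg_left (hle j hj) (hlam j)
      linarith
    have hA := mul_le_mul_of_nonneg_left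
      (min_le_left (r i - ∑ j ∈ Finset.univ.erase i, lam j * r j)
        (vbar * (1 - ∑ j ∈ Finset.univ.erase i, lam j))) (sub_nonneg.2 e1)
    have hB := mul_le_mul_of_nonneg_left
      (min_le_right (r i - ∑ j ∈ Finset.univ.erase i, lam j * r j)
        (vbar * (1 - ∑ j ∈ Finset.univ.erase i, lam j))) e0
    linarith
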